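/- arXiv:q-alg/9710035 — 2 statements merged into one kernel-verified Lean document; each statement's English description precedes it below -/
import Mathlib

section
/- For all 1 ≤ p, q ≤ l and all i, j ∈ ℤ, the operators ê*^{pq} and Ê_{ij} on F commute: ê*^{pq} Ê_{ij} = Ê_{ij} ê*^{pq}. -/
/-!
STATEMENT 4. Fermionic Fock space of `l` pairs of fermionic fields indexed by `½ + ℤ`.

The Fock space `F` is the exterior algebra on the vector space `V` with basis
`v^{ε,p}_{-r}` for `ε ∈ {+,-}` (encoded as `Bool`, `true = +`), `1 ≤ p ≤ l`
(encoded as `Fin l`) and `r ∈ ½ + ℤ`, `r > 0` (encoded as `n : ℕ` with `r = n + ½`).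

For `r > 0`, `ψ^{ε,p}_{-r}` is left exterior multiplication by the basis vector
`v^{ε,p}_{-r}`, and `ψ^{ε,p}_{r}` is the unique odd derivation (i.e. the left
contraction) with `ψ^{ε,p}_{r}(v^{ε',q}_{-r'}) = δ_{ε',-ε} δ_{q,p} δ_{r',r}`.

A general mode `ψ^{ε,p}_{k - ½}` is encoded by `fermion ε p k` for `k : ℤ`.
-/

noncomputable section

/-- Basis index: `(ε, p, n)` corresponds to `v^{ε,p}_{-(n+½)}`. -/
abbrev FBas (l : ℕ) := Bool × Fin l × ℕ

abbrev FV (l : ℕ) := FBas l →₀ ℂ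

/-- The fermionic Fock space: the exterior algebra `Λ(V)`. -/
abbrev FFock (l : ℕ) := ExteriorAlgebra ℂ (FV l)

/-- The vacuum vector `|0⟩ = 1`. -/
def fvac (l : ℕ) : FFock l := 1

/-- Creation operator `ψ^{ε,p}_{-(n+½)}`: left exterior multiplication by `v^{ε,p}_{-(n+½)}`. -/
def psiCr (l : ℕ) (ε : Bool) (p : Fin l) (n : ℕ) : FFock l → FFock l :=
  fun x => ExteriorAlgebra.ι ℂ (Finsupp.single (ε, p, n) (1 : ℂ)) * x

/-- Annihilation operator `ψ^{ε,p}_{n+½}`: the odd derivation (left contraction) dual to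
`v^{-ε,p}_{-(n+½)}`. -/
def psiAn (l : ℕ) (ε : Bool) (p : Fin l) (n : ℕ) : FFock l → FFock l :=
  fun x => CliffordAlgebra.contractLeft (Q := (0 : QuadraticForm ℂ (FV l)))
    (Finsupp.lapply ((!ε, p, n) : FBas l)) x

/-- `fermion ε p k` is the mode `ψ^{ε,p}_{k-½}`, for `k : ℤ`. -/
def fermion (l : ℕ) (ε : Bool) (p : Fin l) (k : ℤ) : FFock l → FFock l :=
  if k ≤ 0 then psiCr l ε p (-k).toNat else psiAn l ε p (k - 1).toNat

/-- Normal ordered product `:ψ^{ε₁,p₁}_{k₁-½} ψ^{ε₂,p₂}_{k₂-½}:`, which is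
`-ψ₂ ψ₁` if `k₁ - ½ > 0 > k₂ - ½` and `ψ₁ ψ₂` otherwise. -/
def nPsi (l : ℕ) (ε₁ : Bool) (p₁ : Fin l) (k₁ : ℤ) (ε₂ : Bool) (p₂ : Fin l) (k₂ : ℤ) :
    FFock l → FFock l :=
  if 1 ≤ k₁ ∧ k₂ ≤ 0 then fun x => -(fermion l ε₂ p₂ k₂ (fermion l ε₁ p₁ k₁ x))
  else fun x => fermion l ε₁ p₁ k₁ (fermion l ε₂ p₂ k₂ x)

/-- `Ê_{ij} = Σ_{p=1}^{l} :ψ^{+,p}_{½-i} ψ^{-,p}_{j-½}:` (note `½ - i = (1-i) - ½`). -/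
def Ehat (l : ℕ) (i j : ℤ) : FFock l → FFock l :=
  fun x => ∑ p : Fin l, nPsi l true p (1 - i) false p j x

/-- `ê*^{pq} = Σ_{r ∈ ½+ℤ} :ψ^{+,p}_{-r} ψ^{-,q}_{r}:`, parametrizing `r = k - ½`, `k : ℤ`. -/
def estar (l : ℕ) (p q : Fin l) : FFock l → FFock l :=
  fun x => ∑ᶠ k : ℤ, nPsi l true p (1 - k) false q k x

/-- The fermionic mode `fermion l ε p k` as a linear endomorphism of the Fock space. -/
def fermionEnd (l : ℕ) (ε : Bool) (p : Fin l) (k : ℤ) : Module.End ℂ (FFock l) :=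
  if k ≤ 0 then
    LinearMap.mulLeft ℂ (ExteriorAlgebra.ι ℂ (Finsupp.single (ε, p, (-k).toNat) (1 : ℂ)))
  else CliffordAlgebra.contractLeft (Q := (0 : QuadraticForm ℂ (FV l)))
    (Finsupp.lapply ((!ε, p, (k - 1).toNat) : FBas l))

theorem fermionEnd_apply (l : ℕ) (ε : Bool) (p : Fin l) (k : ℤ) (x : FFock l) :
    fermionEnd l ε p k x = fermion l ε p k x := by
  unfold fermionEnd fermion
  split_ifs <;> rfl

theorem contractLeft_lapply_ι_single_mul {l : ℕ} (b c : FBas l) (x : FFock l) :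
    CliffordAlgebra.contractLeft (Q := (0 : QuadraticForm ℂ (FV l))) (Finsupp.lapply b)
        (ExteriorAlgebra.ι ℂ (Finsupp.single c (1 : ℂ)) * x) =
      (if c = b then x else 0) - ExteriorAlgebra.ι ℂ (Finsupp.single c (1 : ℂ)) *
        CliffordAlgebra.contractLeft (Q := (0 : QuadraticForm ℂ (FV l))) (Finsupp.lapply b) x := by
  refine (CliffordAlgebra.contractLeft_ι_mul _ _ _).trans ?_
  congr 1
  by_cases h : c = b <;> simp [h]

/-- The canonical anticommutation relations. -/
theorem fermionEnd_anticomm (l : ℕ) (ε ε' : Bool) (p q : Fin l) (m n : ℤ) :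
    fermionEnd l ε p m * fermionEnd l ε' q n + fermionEnd l ε' q n * fermionEnd l ε p m =
      if ε' = !ε ∧ p = q ∧ m + n = 1 then 1 else 0 := by
  refine LinearMap.ext fun x => ?_
  simp only [LinearMap.add_apply, Module.End.mul_apply]
  by_cases hm : m ≤ 0 <;> by_cases hn : n ≤ 0
  · rw [if_neg (by omega)]
    simp only [fermionEnd, hm, hn, if_true, LinearMap.mulLeft_apply, ← mul_assoc, ← add_mul,
      ExteriorAlgebra.ι_add_mul_swap, zero_mul, LinearMap.zero_apply]
  · simp only [fermionEnd, hm, hn, if_true, if_false, LinearMap.mulLeft_apply,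
      contractLeft_lapply_ι_single_mul, add_sub_cancel, Prod.mk.injEq]
    have : (ε = !ε' ∧ p = q ∧ (-m).toNat = (n - 1).toNat) ↔
        (ε' = !ε ∧ p = q ∧ m + n = 1) := by
      refine and_congr (by cases ε <;> cases ε' <;> simp) (and_congr Iff.rfl (by omega))
    simp only [this]
    split_ifs <;> simp
  · simp only [fermionEnd, hm, hn, if_true, if_false, LinearMap.mulLeft_apply,
      contractLeft_lapply_ι_single_mul, sub_add_cancel, Prod.mk.injEq]
    have : (ε' = !ε ∧ q = p ∧ (-n).toNat = (m - 1).toNat) ↔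
        (ε' = !ε ∧ p = q ∧ m + n = 1) :=
      and_congr Iff.rfl (and_congr eq_comm (by omega))
    simp only [this]
    split_ifs <;> simp
  · rw [if_neg (by omega)]
    simp only [fermionEnd, hm, hn, if_false]
    rw [CliffordAlgebra.contractLeft_comm, neg_add_cancel, LinearMap.zero_apply]

/-- The normally ordered product `nPsi` as a linear endomorphism of the Fock space. -/
def nPsiEnd (l : ℕ) (ε₁ : Bool) (p₁ : Fin l) (k₁ : ℤ) (ε₂ : Bool) (p₂ : Fin l) (k₂ : ℤ) :
    Module.End ℂ (FFock l) :=
  if 1 ≤ k₁ ∧ k₂ ≤ 0 then -(fermionEnd l ε₂ p₂ k₂ * fermionEnd l ε₁ p₁ k₁)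
  else fermionEnd l ε₁ p₁ k₁ * fermionEnd l ε₂ p₂ k₂

theorem nPsiEnd_apply (l : ℕ) (ε₁ : Bool) (p₁ : Fin l) (k₁ : ℤ) (ε₂ : Bool) (p₂ : Fin l) (k₂ : ℤ)
    (x : FFock l) : nPsiEnd l ε₁ p₁ k₁ ε₂ p₂ k₂ x = nPsi l ε₁ p₁ k₁ ε₂ p₂ k₂ x := by
  unfold nPsiEnd nPsi
  split_ifs <;> simp [fermionEnd_apply]

theorem mul_mul_eq_of_anticomm {R : Type*} [Ring R] {a b c r s : R} (ha : a * c + c * a = r)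
    (hb : b * c + c * b = s) : a * b * c = c * (a * b) + (a * s - r * b) := by
  subst ha hb
  noncomm_ring

theorem neg_mul_mul_eq_of_anticomm {R : Type*} [Ring R] {a b c r s : R} (ha : a * c + c * a = r)
    (hb : b * c + c * b = s) : -(b * a) * c = c * -(b * a) + (s * a - b * r) := by
  subst ha hb
  noncomm_ring

theorem nPsiEnd_mul_fermionEnd (l : ℕ) (ε ε₁ ε₂ : Bool) (p₁ p₂ s : Fin l) (k₁ k₂ n : ℤ) :
    nPsiEnd l ε₁ p₁ k₁ ε₂ p₂ k₂ * fermionEnd l ε s n =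
      fermionEnd l ε s n * nPsiEnd l ε₁ p₁ k₁ ε₂ p₂ k₂ +
        ((if ε = !ε₂ ∧ p₂ = s ∧ k₂ + n = 1 then fermionEnd l ε₁ p₁ k₁ else 0) -
          (if ε = !ε₁ ∧ p₁ = s ∧ k₁ + n = 1 then fermionEnd l ε₂ p₂ k₂ else 0)) := by
  have h₁ := fermionEnd_anticomm l ε₁ ε p₁ s k₁ n
  have h₂ := fermionEnd_anticomm l ε₂ ε p₂ s k₂ n
  unfold nPsiEnd
  by_cases h : 1 ≤ k₁ ∧ k₂ ≤ 0
  · rw [if_pos h]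
    refine (neg_mul_mul_eq_of_anticomm h₁ h₂).trans ?_
    simp only [mul_ite, ite_mul, mul_one, one_mul, mul_zero, zero_mul]
  · rw [if_neg h]
    refine (mul_mul_eq_of_anticomm h₁ h₂).trans ?_
    simp only [mul_ite, ite_mul, mul_one, one_mul, mul_zero, zero_mul]

theorem finite_setOf_contractLeft_lapply_ne_zero {l : ℕ} (x : FFock l) :
    {b : FBas l | CliffordAlgebra.contractLeft (Q := (0 : QuadraticForm ℂ (FV l)))
      (Finsupp.lapply b) x ≠ 0}.Finite := by
  induction x using CliffordAlgebra.left_induction with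
  | algebraMap r => simp
  | add x y hx hy =>
    refine (hx.union hy).subset fun b hb => ?_
    by_contra! h
    simp only [Set.mem_union, Set.mem_ofPred_eq, not_or, not_not] at h
    exact hb (by rw [map_add, h.1, h.2, add_zero])
  | ι_mul x v hx =>
    refine (hx.union v.hasFiniteSupport).subset fun b hb => ?_
    by_contra! h
    simp only [Set.mem_union, Set.mem_ofPred_eq, not_or, not_not, Function.mem_support] at h
    exact hb (by
      rw [CliffordAlgebra.contractLeft_ι_mul, h.1, Finsupp.lapply_apply, h.2, zero_smul, mul_zero,
        sub_zero])

theorem hasFiniteSupport_nPsiEnd (l : ℕ) (p q : Fin l) (x : FFock l) :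
    (fun k : ℤ => nPsiEnd l true p (1 - k) false q k x).HasFiniteSupport := by
  have hx := finite_setOf_contractLeft_lapply_ne_zero x
  have hf₁ := hx.image fun b : FBas l => (b.2.2 : ℤ) + 1
  have hf₂ := hx.image fun b : FBas l => -(b.2.2 : ℤ)
  refine (hf₁.union hf₂).subset fun k hk => ?_
  rw [Function.mem_support] at hk
  rcases le_or_gt k 0 with h | h
  · refine Or.inr ⟨(false, p, (-k).toNat), fun h0 => hk ?_, by dsimp only; omega⟩
    have h' : ¬ (1 - k ≤ 0) := by omega
    have h0' : fermionEnd l true p (1 - k) x = 0 := by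
      simpa [fermionEnd, h'] using h0
    rw [nPsiEnd, if_pos (by omega), LinearMap.neg_apply, Module.End.mul_apply, h0', map_zero,
      neg_zero]
  · refine Or.inl ⟨(true, q, (k - 1).toNat), fun h0 => hk ?_, by dsimp only; omega⟩
    have h' : ¬ (k ≤ 0) := by omega
    have h0' : fermionEnd l false q k x = 0 := by
      simpa [fermionEnd, h'] using h0
    rw [nPsiEnd, if_neg (by omega), Module.End.mul_apply, h0', map_zero]

/-- `estar` as a linear endomorphism of the Fock space. -/
def estarEnd (l : ℕ) (p q : Fin l) : Module.End ℂ (FFock l) where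
  toFun x := ∑ᶠ k : ℤ, nPsiEnd l true p (1 - k) false q k x
  map_add' x y := by
    simp only [map_add]
    exact finsum_add_distrib (hasFiniteSupport_nPsiEnd l p q x) (hasFiniteSupport_nPsiEnd l p q y)
  map_smul' c x := by
    simp only [map_smul, RingHom.id_apply]
    exact (smul_finsum' c (hasFiniteSupport_nPsiEnd l p q x)).symm

theorem estarEnd_apply (l : ℕ) (p q : Fin l) (x : FFock l) :
    estarEnd l p q x = estar l p q x :=
  finsum_congr fun _ => nPsiEnd_apply ..

theorem estarEnd_mul_eq_of_single {l : ℕ} {p q : Fin l} {c d : Module.End ℂ (FFock l)} (k₀ : ℤ)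
    (h : ∀ k, nPsiEnd l true p (1 - k) false q k * c =
      c * nPsiEnd l true p (1 - k) false q k + if k = k₀ then d else 0) :
    estarEnd l p q * c = c * estarEnd l p q + d := by
  refine LinearMap.ext fun x => ?_
  have hk (k : ℤ) : nPsiEnd l true p (1 - k) false q k (c x) =
      c (nPsiEnd l true p (1 - k) false q k x) + if k = k₀ then d x else 0 := by
    have := LinearMap.congr_fun (h k) x
    simp only [Module.End.mul_apply, LinearMap.add_apply] at this
    rw [this]
    split_ifs <;> rfl
  have hx := hasFiniteSupport_nPsiEnd l p q x
  change ∑ᶠ k : ℤ, nPsiEnd l true p (1 - k) false q k (c x) =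
    c (∑ᶠ k : ℤ, nPsiEnd l true p (1 - k) false q k x) + d x
  simp only [hk]
  rw [finsum_add_distrib (hx.subset fun k h0 h1 => h0 (by simp only [h1, map_zero]))
    ((Set.finite_singleton k₀).subset fun k h0 => by
      by_contra h1
      exact h0 (if_neg h1)), map_finsum c hx, finsum_eq_single _ k₀ fun k h1 => if_neg h1,
    if_pos rfl]

theorem estarEnd_mul_fermionEnd_true (l : ℕ) (p q s : Fin l) (n : ℤ) :
    estarEnd l p q * fermionEnd l true s n =
      fermionEnd l true s n * estarEnd l p q + if q = s then fermionEnd l true p n else 0 := by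
  refine estarEnd_mul_eq_of_single (1 - n) fun k => ?_
  rw [nPsiEnd_mul_fermionEnd]
  by_cases hk : k = 1 - n
  · subst hk
    simp
  · have : ¬ k + n = 1 := by omega
    simp [hk, this]

theorem estarEnd_mul_fermionEnd_false (l : ℕ) (p q s : Fin l) (n : ℤ) :
    estarEnd l p q * fermionEnd l false s n =
      fermionEnd l false s n * estarEnd l p q - if p = s then fermionEnd l false q n else 0 := by
  rw [sub_eq_add_neg]
  refine estarEnd_mul_eq_of_single n fun k => ?_
  rw [nPsiEnd_mul_fermionEnd]
  by_cases hk : k = n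
  · subst hk
    simp
  · have : ¬ 1 - k + n = 1 := by omega
    simp [hk, this]

theorem commute_estarEnd_sum_nPsiEnd (l : ℕ) (p q : Fin l) (m n : ℤ) :
    Commute (estarEnd l p q) (∑ s : Fin l, nPsiEnd l true s m false s n) := by
  unfold nPsiEnd
  split_ifs
  · rw [Finset.sum_neg_distrib]
    refine Commute.neg_right (R := Module.End ℂ (FFock l)) ?_
    have h (s : Fin l) : estarEnd l p q * (fermionEnd l false s n * fermionEnd l true s m) =
        fermionEnd l false s n * fermionEnd l true s m * estarEnd l p q +
        ((if q = s then fermionEnd l false s n * fermionEnd l true p m else 0) -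
          (if p = s then fermionEnd l false q n * fermionEnd l true s m else 0)) := by
      rw [← mul_assoc, estarEnd_mul_fermionEnd_false, sub_mul, mul_assoc,
        estarEnd_mul_fermionEnd_true, mul_add, ← mul_assoc, mul_ite, ite_mul, mul_zero, zero_mul,
        add_sub_assoc]
    simp [Commute, SemiconjBy, Finset.mul_sum, Finset.sum_mul, h, Finset.sum_add_distrib]
  · have h (s : Fin l) : estarEnd l p q * (fermionEnd l true s m * fermionEnd l false s n) =
        fermionEnd l true s m * fermionEnd l false s n * estarEnd l p q +
        ((if q = s then fermionEnd l true p m * fermionEnd l false s n else 0) -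
          (if p = s then fermionEnd l true s m * fermionEnd l false q n else 0)) := by
      rw [← mul_assoc, estarEnd_mul_fermionEnd_true, add_mul, mul_assoc,
        estarEnd_mul_fermionEnd_false, mul_sub, ← mul_assoc, mul_ite, ite_mul, mul_zero, zero_mul]
      abel
    simp [Commute, SemiconjBy, Finset.mul_sum, Finset.sum_mul, h, Finset.sum_add_distrib]

/-- for all `1 ≤ p,q ≤ l` and `i,j ∈ ℤ`, the operators `ê*^{pq}` and `Ê_{ij}`
on the Fock space commute. -/
theorem estar_comm_Ehat (l : ℕ) (hl : 1 ≤ l) (p q : Fin l) (i j : ℤ) (x : FFock l) :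
    estar l p q (Ehat l i j x) = Ehat l i j (estar l p q x) := by
  have h := LinearMap.congr_fun (commute_estarEnd_sum_nPsiEnd l p q (1 - i) j).eq x
  simpa only [Module.End.mul_apply, LinearMap.sum_apply, nPsiEnd_apply, estarEnd_apply, Ehat]
    using h

end
end

section
/- (1) D̂'_{1−j,1−i} = −D̂'_{ij} for all i, j ∈ ℤ. (2) For every a ∈ d̄∞ := {a ∈ gl : a_{ij} = −a_{1−j,1−i} for all i,j} and every x ∈ F′, only finitely many terms of Φ(a)x := ½ Σ_{i,j∈ℤ} a_{ij} D̂'_{ij} x are nonzero, so Φ(a) ∈ End(F′) is well defined, and Φ(E_{ij} − E_{1−j,1−i}) = D̂'_{ij}. (3) The map a + λC ↦ Φ(a) + λ·(l+½)·id is a Lie algebra homomorphism from the central extension d∞ := d̄∞ ⊕ ℂC, with bracket [a+λC, b+μC] = (ab−ba) + C(a,b)·C, into End(F′); i.e. the operators D̂'_{ij} define a representation of d∞ on F′ of central charge l + ½. -/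
/-!
Fermionic Fock space of `l` pairs of fermionic fields together with one neutral fermionic
field, all indexed by `½ + ℤ`.

The Fock space `PFock l` is the exterior algebra on the space `PV l` with basis
`v^{ε,p}_{-r}` (`ε ∈ {+,-}`, `1 ≤ p ≤ l`, `r ∈ ½+ℤ`, `r > 0`) and `w_{-r}` (`r ∈ ½+ℤ`,
`r > 0`), encoded as `Sum.inl (ε, p, n)` resp. `Sum.inr n` with `r = n + ½`.
For `r > 0`, `ψ^{ε,p}_{-r}` (resp. `φ_{-r}`) is left exterior multiplication by
`v^{ε,p}_{-r}` (resp. `w_{-r}`), while `ψ^{ε,p}_{r}` (resp. `φ_{r}`) is the unique odd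
derivation (left contraction) sending `v^{-ε,p}_{-r}` (resp. `w_{-r}`) to `1` and all
other basis vectors to `0`.  A general mode with index `k - ½`, `k : ℤ`, is encoded by
`pfermion ε p k` resp. `pphi k`.
-/

noncomputable section

/-- Basis index: `Sum.inl (ε, p, n) ↔ v^{ε,p}_{-(n+½)}`, `Sum.inr n ↔ w_{-(n+½)}`. -/
abbrev PBas (l : ℕ) := (Bool × Fin l × ℕ) ⊕ ℕ

abbrev PV (l : ℕ) := PBas l →₀ ℂ

/-- The Fock space `F' = Λ(V)`. -/
abbrev PFock (l : ℕ) := ExteriorAlgebra ℂ (PV l)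

/-- The vacuum vector `|0⟩ = 1`. -/
def pvac (l : ℕ) : PFock l := 1

/-- Left exterior multiplication by the basis vector with index `b`. -/
def pCr (l : ℕ) (b : PBas l) : PFock l → PFock l :=
  fun x => ExteriorAlgebra.ι ℂ (Finsupp.single b (1 : ℂ)) * x

/-- The odd derivation (left contraction) dual to the basis vector with index `b`. -/
def pAn (l : ℕ) (b : PBas l) : PFock l → PFock l :=
  fun x => CliffordAlgebra.contractLeft (Q := (0 : QuadraticForm ℂ (PV l)))
    (Finsupp.lapply b) x

/-- The mode `ψ^{ε,p}_{k-½}`, `k : ℤ`. -/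
def pfermion (l : ℕ) (ε : Bool) (p : Fin l) (k : ℤ) : PFock l → PFock l :=
  if k ≤ 0 then pCr l (Sum.inl (ε, p, (-k).toNat))
  else pAn l (Sum.inl (!ε, p, (k - 1).toNat))

/-- The neutral fermion mode `φ_{k-½}`, `k : ℤ`. -/
def pphi (l : ℕ) (k : ℤ) : PFock l → PFock l :=
  if k ≤ 0 then pCr l (Sum.inr (-k).toNat) else pAn l (Sum.inr (k - 1).toNat)

/-- Normal ordered product `:ψ^{ε₁,p₁}_{k₁-½} ψ^{ε₂,p₂}_{k₂-½}:`. -/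
def pnPsi (l : ℕ) (ε₁ : Bool) (p₁ : Fin l) (k₁ : ℤ) (ε₂ : Bool) (p₂ : Fin l) (k₂ : ℤ) :
    PFock l → PFock l :=
  if 1 ≤ k₁ ∧ k₂ ≤ 0 then fun x => -(pfermion l ε₂ p₂ k₂ (pfermion l ε₁ p₁ k₁ x))
  else fun x => pfermion l ε₁ p₁ k₁ (pfermion l ε₂ p₂ k₂ x)

/-- Normal ordered product `:φ_{k₁-½} φ_{k₂-½}:`. -/
def pnPhi (l : ℕ) (k₁ k₂ : ℤ) : PFock l → PFock l :=
  if 1 ≤ k₁ ∧ k₂ ≤ 0 then fun x => -(pphi l k₂ (pphi l k₁ x))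
  else fun x => pphi l k₁ (pphi l k₂ x)

/-- Normal ordered product `:ψ^{ε,p}_{k₁-½} φ_{k₂-½}:`. -/
def pnPsiPhi (l : ℕ) (ε : Bool) (p : Fin l) (k₁ k₂ : ℤ) : PFock l → PFock l :=
  if 1 ≤ k₁ ∧ k₂ ≤ 0 then fun x => -(pphi l k₂ (pfermion l ε p k₁ x))
  else fun x => pfermion l ε p k₁ (pphi l k₂ x)

/-- `Ê_{ij} = Σ_{p=1}^{l} :ψ^{+,p}_{½-i} ψ^{-,p}_{j-½}:`. -/
def pEhat (l : ℕ) (i j : ℤ) : PFock l → PFock l :=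
  fun x => ∑ p : Fin l, pnPsi l true p (1 - i) false p j x

/-- `D̂'_{ij} = Ê_{ij} - Ê_{1-j,1-i} + :φ_{½-i} φ_{j-½}:`. -/
def pDhat (l : ℕ) (i j : ℤ) : PFock l → PFock l :=
  fun x => pEhat l i j x - pEhat l (1 - j) (1 - i) x + pnPhi l (1 - i) j x

/-!
The Lie algebra `gl` of `ℤ×ℤ` complex matrices with finitely many nonzero diagonals.
-/

/-- A `ℤ×ℤ` matrix (given as `a : ℤ → ℤ → ℂ`, `a i j` the `(i,j)` entry) belongs to `gl`
iff it has only finitely many nonzero diagonals. -/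
def IsGL (a : ℤ → ℤ → ℂ) : Prop := ∃ N : ℕ, ∀ i j : ℤ, (N : ℤ) < |i - j| → a i j = 0

/-- The matrix product on `gl`: each entry is a (finitely supported) sum. -/
def glMul (a b : ℤ → ℤ → ℂ) : ℤ → ℤ → ℂ := fun i j => ∑ᶠ k : ℤ, a i k * b k j

/-- The bracket `[a,b] = ab - ba` on `gl`. -/
def glBracket (a b : ℤ → ℤ → ℂ) : ℤ → ℤ → ℂ := fun i j => glMul a b i j - glMul b a i j

/-- The elementary matrix `E_{ij}`. -/
def Emat (i j : ℤ) : ℤ → ℤ → ℂ := fun m n => if m = i ∧ n = j then 1 else 0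

/-- The 2-cocycle `C(a,b) = Σ_{i≤0<j} a_{ij} b_{ji} - Σ_{j≤0<i} a_{ij} b_{ji}` on `gl`
(both sums are finitely supported for `a, b ∈ gl`). -/
def glCocycle (a b : ℤ → ℤ → ℂ) : ℂ :=
  (∑ᶠ p : ℤ × ℤ, if p.1 ≤ 0 ∧ 0 < p.2 then a p.1 p.2 * b p.2 p.1 else 0) -
  (∑ᶠ p : ℤ × ℤ, if p.2 ≤ 0 ∧ 0 < p.1 then a p.1 p.2 * b p.2 p.1 else 0)

/-- The set `d̄∞`: matrices in `gl` with `a_{ij} = -a_{1-j,1-i}`. -/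
def IsDinf (a : ℤ → ℤ → ℂ) : Prop := ∀ i j : ℤ, a i j = - a (1 - j) (1 - i)

/-- `Φ(a) x := ½ Σ_{i,j ∈ ℤ} a_{ij} D̂'_{ij} x` (a finitely supported sum, by part (2) of
the theorem below). -/
def pDhatGL (l : ℕ) (a : ℤ → ℤ → ℂ) : PFock l → PFock l :=
  fun x => (1 / 2 : ℂ) • ∑ᶠ p : ℤ × ℤ, a p.1 p.2 • pDhat l p.1 p.2 x

namespace PFock

variable {l : ℕ}

/-- The species of fields: `some (ε, p)` is `ψ^{ε,p}` and `none` is `φ`. -/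
abbrev Species (l : ℕ) := Option (Bool × Fin l)

/-- The involution exchanging `ψ^{+,p}` and `ψ^{-,p}` and fixing `φ`. -/
def conj (s : Species l) : Species l := s.map fun q => (!q.1, q.2)

@[simp] theorem conj_conj (s : Species l) : conj (conj s) = s := by
  cases s <;> simp [conj]

/-- `conj` as a permutation of the species. -/
def conjEquiv (l : ℕ) : Species l ≃ Species l := ⟨conj, conj, conj_conj, conj_conj⟩

/-- The basis vector of `PV l` of species `s` and label `-(n+½)`. -/
def basIdx : Species l → ℕ → PBas l
  | some q, n => Sum.inl (q.1, q.2, n)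
  | none, n => Sum.inr n

theorem basIdx_inj {s t : Species l} {m n : ℕ} :
    basIdx s m = basIdx t n ↔ s = t ∧ m = n := by
  rcases s with _ | ⟨a, b⟩ <;> rcases t with _ | ⟨c, d⟩ <;> simp [basIdx, and_assoc]

theorem exists_basIdx (b : PBas l) : ∃ s n, b = basIdx s n := by
  rcases b with ⟨a, p, n⟩ | n
  · exact ⟨some (a, p), n, rfl⟩
  · exact ⟨none, n, rfl⟩

/-- `pCr` as a linear map. -/
def creation (b : PBas l) : Module.End ℂ (PFock l) :=
  LinearMap.mulLeft ℂ (ExteriorAlgebra.ι ℂ (Finsupp.single b (1 : ℂ)))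

/-- `pAn` as a linear map. -/
def annihilation (b : PBas l) : Module.End ℂ (PFock l) :=
  CliffordAlgebra.contractLeft (Q := (0 : QuadraticForm ℂ (PV l))) (Finsupp.lapply b)

theorem creation_apply (b : PBas l) (x : PFock l) :
    creation b x = ExteriorAlgebra.ι ℂ (Finsupp.single b (1 : ℂ)) * x := rfl

theorem annihilation_ι_mul (b : PBas l) (v : PV l) (x : PFock l) :
    annihilation b (ExteriorAlgebra.ι ℂ v * x)
      = v b • x - ExteriorAlgebra.ι ℂ v * annihilation b x :=
  CliffordAlgebra.contractLeft_ι_mul _ _ _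

theorem annihilation_algebraMap (b : PBas l) (r : ℂ) :
    annihilation b (algebraMap ℂ (PFock l) r) = 0 :=
  CliffordAlgebra.contractLeft_algebraMap _ _ _

theorem annihilation_annihilation (b c : PBas l) (x : PFock l) :
    annihilation b (annihilation c x) = -annihilation c (annihilation b x) :=
  CliffordAlgebra.contractLeft_comm _ _ _

/-- The mode with label `k - ½` of the field of species `s`. -/
def mode (s : Species l) (k : ℤ) : Module.End ℂ (PFock l) :=
  if k ≤ 0 then creation (basIdx s (-k).toNat) else annihilation (basIdx (conj s) (k - 1).toNat)

theorem pfermion_eq (ε : Bool) (p : Fin l) (k : ℤ) (x : PFock l) :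
    pfermion l ε p k x = mode (some (ε, p)) k x := by
  unfold pfermion mode; split_ifs <;> rfl

theorem pphi_eq (k : ℤ) (x : PFock l) : pphi l k x = mode none k x := by
  unfold pphi mode; split_ifs <;> rfl

/-- The canonical anticommutation relations. -/
theorem mode_anticomm (s t : Species l) (k m : ℤ) (x : PFock l) :
    mode s k (mode t m x) + mode t m (mode s k x)
      = if t = conj s ∧ k + m = 1 then x else 0 := by
  have key : ∀ (u : Species l) (a : ℤ) (v : Species l) (c : ℤ), a ≤ 0 → ¬ c ≤ 0 →
      annihilation (basIdx (conj v) (c - 1).toNat) (creation (basIdx u (-a).toNat) x)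
      = (if u = conj v ∧ a + c = 1 then x else 0) - 
        creation (basIdx u (-a).toNat) (annihilation (basIdx (conj v) (c - 1).toNat) x) := by
    intro u a v c ha hc
    rw [creation_apply, annihilation_ι_mul, creation_apply, Finsupp.single_apply, ite_smul,
      one_smul, zero_smul]
    congr 1
    refine if_congr ?_ rfl rfl
    rw [basIdx_inj]
    refine and_congr_right fun _ => ?_
    omega
  unfold mode
  split_ifs with h1 h2 h3 h3 h2 h3 h3
  · omega
  · rw [creation_apply, creation_apply, creation_apply, creation_apply, ← mul_assoc, ← mul_assoc,
      ← add_mul, ExteriorAlgebra.ι_add_mul_swap, zero_mul]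
  · rw [key _ _ _ _ h1 h2, if_pos ⟨by rw [h3.1, conj_conj], h3.2⟩]; abel
  · rw [key _ _ _ _ h1 h2, if_neg fun h => h3 ⟨by rw [h.1, conj_conj], h.2⟩]; abel
  · rw [key _ _ _ _ h2 h1, if_pos ⟨h3.1, by omega⟩]; abel
  · rw [key _ _ _ _ h2 h1, if_neg fun h => h3 ⟨h.1, by omega⟩]; abel
  · omega
  · rw [annihilation_annihilation]; abel

theorem mode_vacuum (s : Species l) {k : ℤ} (hk : 1 ≤ k) : mode s k (1 : PFock l) = 0 := by
  rw [mode, if_neg (by omega), ← map_one (algebraMap ℂ (PFock l)), annihilation_algebraMap]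

/-- The vacuum expectation functional. -/
def vev : PFock l →ₗ[ℂ] ℂ := (ExteriorAlgebra.algebraMapInv (R := ℂ) (M := PV l)).toLinearMap

theorem vev_algebraMap (r : ℂ) : vev (algebraMap ℂ (PFock l) r) = r :=
  ExteriorAlgebra.algebraMap_leftInverse (PV l) r

theorem vev_one : vev (1 : PFock l) = 1 := by
  simp [vev]

theorem vev_ι_mul (v : PV l) (x : PFock l) : vev (ExteriorAlgebra.ι ℂ v * x) = 0 := by
  simp [vev, ExteriorAlgebra.algebraMapInv]

theorem vev_mode (s : Species l) {k : ℤ} (hk : k ≤ 0) (x : PFock l) : vev (mode s k x) = 0 := by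
  rw [mode, if_pos hk, creation_apply, vev_ι_mul]

/-- The two-point function. -/
theorem vev_mode_mode (s : Species l) (k m : ℤ) :
    vev (mode s k (mode (conj s) m (1 : PFock l))) = if k + m = 1 ∧ m ≤ 0 then 1 else 0 := by
  by_cases hm : m ≤ 0
  · by_cases hk : k ≤ 0
    · rw [vev_mode s hk, if_neg (by omega)]
    · have h := mode_anticomm s (conj s) k m 1
      rw [mode_vacuum s (by omega), map_zero, add_zero] at h
      rw [h]
      by_cases h1 : k + m = 1 <;> simp [h1, hm, vev_one]
  · rw [mode_vacuum _ (by omega), map_zero, map_zero, if_neg (by omega)]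

/-- Every vector is killed by all modes of sufficiently large label. -/
theorem exists_mode_eq_zero (x : PFock l) : ∃ K : ℕ, ∀ (s : Species l) (k : ℤ), K < k →
    mode s k x = 0 := by
  induction x using CliffordAlgebra.left_induction with
  | algebraMap r =>
    refine ⟨0, fun s k hk => ?_⟩
    rw [mode, if_neg (by omega)]
    exact annihilation_algebraMap _ r
  | add x y hx hy =>
    obtain ⟨K, hK⟩ := hx
    obtain ⟨L, hL⟩ := hy
    refine ⟨max K L, fun s k hk => ?_⟩
    rw [map_add, hK s k (by omega), hL s k (by omega), add_zero]
  | ι_mul x v hx =>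
    obtain ⟨K, hK⟩ := hx
    let height : PBas l → ℕ := Sum.elim (fun q => q.2.2) id
    refine ⟨max K (v.support.sup height + 1), fun s k hk => ?_⟩
    have h0 := hK s k (by omega)
    rw [mode, if_neg (by omega)] at h0 ⊢
    have hv : v (basIdx (conj s) (k - 1).toNat) = 0 := by
      by_contra h
      have := Finset.le_sup (f := height) (Finsupp.mem_support_iff.2 h)
      have h2 : height (basIdx (conj s) (k - 1).toNat) = (k - 1).toNat := by
        rcases conj s with _ | q <;> rfl
      omega
    refine (annihilation_ι_mul _ v x).trans ?_
    rw [h0, hv, zero_smul, mul_zero, sub_zero]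

/-- The endomorphism of `PV l` setting the coordinates in `F` to zero. -/
def eraseCoords (F : Finset (PBas l)) : PV l →ₗ[ℂ] PV l where
  toFun := Finsupp.filter (· ∉ F)
  map_add' _ _ := Finsupp.filter_add
  map_smul' _ _ := Finsupp.filter_smul

theorem eraseCoords_singleton (b : PBas l) (v : PV l) :
    eraseCoords {b} v = v - v b • Finsupp.single b 1 := by
  ext c
  by_cases h : c = b
  · subst h; simp [eraseCoords]
  · simp [eraseCoords, h]

theorem eraseCoords_insert (b : PBas l) (F : Finset (PBas l)) :
    eraseCoords (insert b F) = eraseCoords {b} ∘ₗ eraseCoords F := by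
  ext c d
  simp only [eraseCoords, LinearMap.coe_comp, LinearMap.coe_mk, AddHom.coe_mk,
    Function.comp_apply, Finsupp.filter_apply, Finset.mem_insert, Finset.mem_singleton]
  split_ifs <;> tauto

theorem map_eraseCoords_singleton (b : PBas l) (x : PFock l) :
    ExteriorAlgebra.map (eraseCoords {b}) x = x - creation b (annihilation b x) := by
  induction x using CliffordAlgebra.left_induction with
  | algebraMap r =>
    rw [annihilation_algebraMap, map_zero, sub_zero]
    exact AlgHom.commutes _ r
  | add x y hx hy => rw [map_add, map_add, map_add, hx, hy]; abel
  | ι_mul x v hx =>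
    change ExteriorAlgebra.map (eraseCoords {b}) (ExteriorAlgebra.ι ℂ v * x)
      = ExteriorAlgebra.ι ℂ v * x - creation b (annihilation b (ExteriorAlgebra.ι ℂ v * x))
    have h1 : ∀ y : PFock l, ExteriorAlgebra.ι ℂ (Finsupp.single b (1 : ℂ)) *
        (ExteriorAlgebra.ι ℂ (Finsupp.single b (1 : ℂ)) * y) = 0 := fun y => by
      rw [← mul_assoc, ExteriorAlgebra.ι_sq_zero, zero_mul]
    have h2 : ∀ y : PFock l, ExteriorAlgebra.ι ℂ (Finsupp.single b (1 : ℂ)) *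
        (ExteriorAlgebra.ι ℂ v * y) =
        -(ExteriorAlgebra.ι ℂ v * (ExteriorAlgebra.ι ℂ (Finsupp.single b (1 : ℂ)) * y)) :=
      fun y => by
      rw [← mul_assoc, ← mul_assoc, eq_neg_iff_add_eq_zero, ← add_mul,
        ExteriorAlgebra.ι_add_mul_swap, zero_mul]
    rw [map_mul, hx, ExteriorAlgebra.map_apply_ι, eraseCoords_singleton, annihilation_ι_mul]
    simp only [creation_apply, map_sub, map_smul, mul_sub, sub_mul, smul_mul_assoc,
      h1, h2, smul_zero, sub_zero]
    abel

theorem exists_map_eraseCoords (x : PFock l) : ∃ F : Finset (PBas l), ∀ G, F ⊆ G →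
    ExteriorAlgebra.map (eraseCoords G) x = algebraMap ℂ (PFock l) (vev x) := by
  induction x using CliffordAlgebra.left_induction with
  | algebraMap r =>
    refine ⟨∅, fun G _ => ?_⟩
    exact (AlgHom.commutes _ r).trans (congrArg _ (vev_algebraMap r).symm)
  | add x y hx hy =>
    obtain ⟨F, hF⟩ := hx
    obtain ⟨F', hF'⟩ := hy
    refine ⟨F ∪ F', fun G hG => ?_⟩
    rw [map_add, hF G (Finset.union_subset_left hG), hF' G (Finset.union_subset_right hG),
      map_add, map_add]
  | ι_mul x v _ =>
    refine ⟨v.support, fun G hG => ?_⟩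
    change ExteriorAlgebra.map (eraseCoords G) (ExteriorAlgebra.ι ℂ v * x)
      = algebraMap ℂ (PFock l) (vev (ExteriorAlgebra.ι ℂ v * x))
    have hv : eraseCoords G v = 0 := by
      ext c
      by_cases hc : c ∈ G
      · simp [eraseCoords, hc]
      · simpa [eraseCoords, hc] using fun h => hc (hG (Finsupp.mem_support_iff.2 h))
    rw [map_mul, ExteriorAlgebra.map_apply_ι, hv, map_zero, zero_mul, vev_ι_mul, map_zero]

/-- A vector killed by all annihilation operators is a multiple of the vacuum. -/
theorem eq_vev_of_annihilation_eq_zero (y : PFock l) (hy : ∀ b, annihilation b y = 0) :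
    y = algebraMap ℂ (PFock l) (vev y) := by
  obtain ⟨F, hF⟩ := exists_map_eraseCoords y
  rw [← hF F subset_rfl]
  clear hF
  induction F using Finset.induction_on with
  | empty =>
    have : eraseCoords (∅ : Finset (PBas l)) = LinearMap.id := by
      ext c d; simp [eraseCoords]
    rw [this, ExteriorAlgebra.map_id, AlgHom.id_apply]
  | insert b F _ ih =>
    rw [eraseCoords_insert, ← ExteriorAlgebra.map_comp_map, AlgHom.comp_apply, ← ih,
      map_eraseCoords_singleton, hy, map_zero, sub_zero]

/-- An operator commuting with all modes and with vanishing vacuum expectation is zero. -/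
theorem eq_zero_of_commute_mode (R : Module.End ℂ (PFock l))
    (hR : ∀ s k x, R (mode s k x) = mode s k (R x)) (h0 : vev (R 1) = 0) (x : PFock l) :
    R x = 0 := by
  have hcr : ∀ b x, R (creation b x) = creation b (R x) := fun b x => by
    obtain ⟨s, n, rfl⟩ := exists_basIdx b
    have := hR s (-n) x
    rwa [mode, if_pos (by omega), neg_neg, Int.toNat_natCast] at this
  have han : ∀ b x, R (annihilation b x) = annihilation b (R x) := fun b x => by
    obtain ⟨s, n, rfl⟩ := exists_basIdx b
    have := hR (conj s) (n + 1) x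
    rwa [mode, if_neg (by omega), conj_conj, add_sub_cancel_right, Int.toNat_natCast] at this
  have h1 : R 1 = 0 := by
    rw [eq_vev_of_annihilation_eq_zero (R 1), h0, map_zero]
    intro b
    rw [← han, ← map_one (algebraMap ℂ (PFock l)), annihilation_algebraMap, map_zero]
  induction x using CliffordAlgebra.left_induction with
  | algebraMap r =>
    have : algebraMap ℂ (PFock l) r = r • 1 := Algebra.algebraMap_eq_smul_one r
    exact (congrArg R this).trans (by rw [map_smul, h1, smul_zero])
  | add x y hx hy => rw [map_add, hx, hy, add_zero]
  | ι_mul x v hx =>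
    change R (ExteriorAlgebra.ι ℂ v * x) = 0
    induction v using Finsupp.induction_linear with
    | zero => rw [map_zero, zero_mul, map_zero]
    | add v w hv hw => rw [map_add, add_mul, map_add, hv, hw, add_zero]
    | single b c =>
      have : ExteriorAlgebra.ι ℂ (Finsupp.single b c) * x = c • creation b x := by
        rw [creation_apply, ← smul_mul_assoc, ← map_smul, Finsupp.smul_single, smul_eq_mul, mul_one]
      rw [this, map_smul, hcr, hx, map_zero, smul_zero]

/-- Normal ordering of `mode s k` and `mode (conj s) m` subtracts their contraction. -/
theorem normalOrder_eq (s : Species l) (k m : ℤ) (x : PFock l) :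
    (if 1 ≤ k ∧ m ≤ 0 then -mode (conj s) m (mode s k x) else mode s k (mode (conj s) m x))
      = mode s k (mode (conj s) m x) - if k + m = 1 ∧ m ≤ 0 then x else 0 := by
  have h := mode_anticomm s (conj s) k m x
  simp only [true_and] at h
  by_cases h1 : 1 ≤ k ∧ m ≤ 0
  · rw [if_pos h1, eq_sub_of_add_eq h]
    simp only [h1.2, and_true]
    abel
  · rw [if_neg h1, if_neg (by omega), sub_zero]

theorem mode_mode_sub_eq_neg (s : Species l) (k m : ℤ) (x : PFock l) :
    mode (conj s) m (mode s k x) - (if m + k = 1 ∧ k ≤ 0 then x else 0)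
      = -(mode s k (mode (conj s) m x) - if k + m = 1 ∧ m ≤ 0 then x else 0) := by
  have h := mode_anticomm s (conj s) k m x
  simp only [true_and] at h
  rw [eq_sub_of_add_eq h]
  by_cases h1 : k + m = 1
  · by_cases h2 : m ≤ 0
    · simp only [if_pos h1, if_neg (by omega : ¬(m + k = 1 ∧ k ≤ 0)),
        if_pos (⟨h1, h2⟩ : k + m = 1 ∧ m ≤ 0)]
      abel
    · simp only [if_pos h1, if_pos (by omega : m + k = 1 ∧ k ≤ 0),
        if_neg (by omega : ¬(k + m = 1 ∧ m ≤ 0))]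
      abel
  · simp only [if_neg h1, if_neg (by omega : ¬(m + k = 1 ∧ k ≤ 0)),
      if_neg (by omega : ¬(k + m = 1 ∧ m ≤ 0))]
    abel

/-- The operator `D̂'_{ij}`, as a linear map. -/
def dhat (i j : ℤ) : Module.End ℂ (PFock l) :=
  ∑ s : Species l, (mode s (1 - i) * mode (conj s) j - if i = j ∧ j ≤ 0 then 1 else 0)

theorem dhat_apply (i j : ℤ) (x : PFock l) :
    dhat i j x = ∑ s : Species l,
      (mode s (1 - i) (mode (conj s) j x) - if i = j ∧ j ≤ 0 then x else 0) := by
  rw [dhat, LinearMap.sum_apply]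
  refine Finset.sum_congr rfl fun s _ => ?_
  split_ifs <;> simp

theorem pDhat_eq (i j : ℤ) (x : PFock l) : pDhat l i j x = dhat i j x := by
  have hpsi : ∀ ε p k m, pnPsi l ε p k (!ε) p m x
      = mode (some (ε, p)) k (mode (some (!ε, p)) m x) - if k + m = 1 ∧ m ≤ 0 then x else 0 := by
    intro ε p k m
    refine Eq.trans ?_ (normalOrder_eq (some (ε, p)) k m x)
    unfold pnPsi
    split_ifs <;> simp only [pfermion_eq] <;> rfl
  have hphi : ∀ k m, pnPhi l k m x
      = mode none k (mode none m x) - if k + m = 1 ∧ m ≤ 0 then x else 0 := by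
    intro k m
    refine Eq.trans ?_ (normalOrder_eq none k m x)
    unfold pnPhi
    split_ifs <;> simp only [pphi_eq] <;> rfl
  have hc : (i = j ∧ j ≤ 0) ↔ (1 - i + j = 1 ∧ j ≤ 0) := by omega
  have ht : ∀ k m, pEhat l k m x = ∑ p, (mode (some (true, p)) (1 - k)
      (mode (some (false, p)) m x) - if 1 - k + m = 1 ∧ m ≤ 0 then x else 0) := fun k m =>
    Finset.sum_congr rfl fun p _ => hpsi true p (1 - k) m
  simp only [dhat_apply, pDhat, ht, hphi, hc, Fintype.sum_option, Fintype.sum_prod_type,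
    Fintype.sum_bool, sub_sub_cancel]
  have hf : ∀ p : Fin l, mode (some (true, p)) j (mode (some (false, p)) (1 - i) x)
      - (if j + (1 - i) = 1 ∧ 1 - i ≤ 0 then x else 0)
      = -(mode (some (false, p)) (1 - i) (mode (some (true, p)) j x)
        - if 1 - i + j = 1 ∧ j ≤ 0 then x else 0) := fun p =>
    mode_mode_sub_eq_neg (some (false, p)) (1 - i) j x
  simp only [hf, Finset.sum_neg_distrib]
  simp only [conj, Option.map_some, Option.map_none, Bool.not_true, Bool.not_false]
  abel

theorem dhat_symm (i j : ℤ) (x : PFock l) : dhat (1 - j) (1 - i) x = -dhat i j x := by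
  rw [dhat_apply, dhat_apply, ← Finset.sum_neg_distrib, ← (conjEquiv l).sum_comp]
  refine Finset.sum_congr rfl fun s _ => ?_
  have h := mode_mode_sub_eq_neg s (1 - i) j x
  have hc : (i = j ∧ j ≤ 0) ↔ (1 - i + j = 1 ∧ j ≤ 0) := by omega
  have hc' : (1 - j = 1 - i ∧ 1 - i ≤ 0) ↔ (j + (1 - i) = 1 ∧ 1 - i ≤ 0) := by omega
  simpa only [hc, hc', conjEquiv, Equiv.coe_fn_mk, conj_conj, sub_sub_cancel] using h

/-- `[D̂'_{ij}, χ_k] = δ_{j,1-k} χ_{1-i} - δ_{ik} χ_j` for a field `χ` of any species. -/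
theorem dhat_mode (i j : ℤ) (t : Species l) (k : ℤ) (x : PFock l) :
    dhat i j (mode t k x) = mode t k (dhat i j x)
      + ((if j = 1 - k then mode t (1 - i) x else 0) - if i = k then mode t j x else 0) := by
  have key : ∀ s : Species l, mode s (1 - i) (mode (conj s) j (mode t k x))
      = mode t k (mode s (1 - i) (mode (conj s) j x))
        + ((if t = s then if j = 1 - k then mode t (1 - i) x else 0 else 0)
        - if t = conj s then if i = k then mode t j x else 0 else 0) := by
    intro s
    have h1 := mode_anticomm (conj s) t j k x
    have h2 := mode_anticomm s t (1 - i) k (mode (conj s) j x)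
    rw [eq_sub_of_add_eq h1, map_sub, eq_sub_of_add_eq h2]
    have e1 : (if t = conj (conj s) ∧ j + k = 1 then x else 0)
        = if t = s then if j = 1 - k then x else 0 else 0 := by
      rw [conj_conj, ← ite_and]
      exact if_congr (and_congr_right fun _ => by omega) rfl rfl
    have e2 : (if t = conj s ∧ 1 - i + k = 1 then mode (conj s) j x else 0)
        = if t = conj s then if i = k then mode t j x else 0 else 0 := by
      by_cases ht : t = conj s
      · subst ht
        rw [if_pos rfl]
        exact if_congr ⟨fun h => by omega, fun h => ⟨rfl, by omega⟩⟩ rfl rfl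
      · rw [if_neg ht, if_neg fun h => ht h.1]
    have e3 : mode s (1 - i) (if t = s then if j = 1 - k then x else 0 else 0)
        = if t = s then if j = 1 - k then mode t (1 - i) x else 0 else 0 := by
      split_ifs with h h'
      · rw [h]
      all_goals exact map_zero _
    rw [e1, e2, e3]
    abel
  have e : ∀ s : Species l, t = conj s ↔ conj t = s := fun s =>
    ⟨fun h => by rw [h, conj_conj], fun h => by rw [← h, conj_conj]⟩
  simp only [dhat_apply, key, map_sum, map_sub, Finset.sum_sub_distrib, Finset.sum_add_distrib, e,
    Finset.sum_ite_eq, Finset.mem_univ, if_true, apply_ite (mode t k), map_zero]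
  abel

theorem finite_smul_dhat {a : ℤ → ℤ → ℂ} (ha : IsGL a) (x : PFock l) :
    (Function.support fun p : ℤ × ℤ => a p.1 p.2 • dhat p.1 p.2 x).Finite := by
  obtain ⟨N, hN⟩ := ha
  obtain ⟨K, hK⟩ := exists_mode_eq_zero x
  refine (Finset.finite_toSet (Finset.Icc (-(K + N : ℤ)) (K + N) ×ˢ
    Finset.Icc (-(K + N : ℤ)) (K + N))).subset fun ⟨i, j⟩ hp => ?_
  have h1 : |i - j| ≤ N := by
    by_contra h
    exact hp (by simp [hN i j (by omega)])
  rw [abs_le] at h1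
  have h2 : j ≤ K := by
    by_contra h
    refine hp ?_
    simp only [dhat_apply]
    rw [Finset.sum_eq_zero, smul_zero]
    intro s _
    rw [hK _ _ (by omega), map_zero, if_neg (by omega), sub_zero]
  have h3 : 1 - i ≤ K := by
    by_contra h
    refine hp ?_
    simp only [dhat_apply]
    rw [Finset.sum_eq_zero, smul_zero]
    intro s _
    have := normalOrder_eq s (1 - i) j x
    have hc : (i = j ∧ j ≤ 0) ↔ (1 - i + j = 1 ∧ j ≤ 0) := by omega
    simp only [hc]
    rw [← this]
    split_ifs with h'
    · rw [hK _ _ (by omega), map_zero, neg_zero]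
    · have h4 := mode_anticomm s (conj s) (1 - i) j x
      rw [hK s (1 - i) (by omega), map_zero, add_zero] at h4
      rw [h4, if_neg (by omega)]
  simp only [Finset.coe_product, Finset.coe_Icc, Set.mem_prod, Set.mem_Icc]
  omega

/-- `Φ(a)` as a linear map. -/
def phi (a : ℤ → ℤ → ℂ) (ha : IsGL a) : Module.End ℂ (PFock l) where
  toFun x := (1 / 2 : ℂ) • ∑ᶠ p : ℤ × ℤ, a p.1 p.2 • dhat p.1 p.2 x
  map_add' x y := by
    simp only [map_add, smul_add]
    rw [finsum_add_distrib (finite_smul_dhat ha x) (finite_smul_dhat ha y), smul_add]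
  map_smul' c x := by
    simp only [map_smul, smul_comm _ c, RingHom.id_apply]
    rw [← smul_finsum, smul_comm]

theorem phi_apply (a : ℤ → ℤ → ℂ) (ha : IsGL a) (x : PFock l) :
    phi a ha x = (1 / 2 : ℂ) • ∑ᶠ p : ℤ × ℤ, a p.1 p.2 • dhat p.1 p.2 x := rfl

theorem pDhatGL_eq (a : ℤ → ℤ → ℂ) (ha : IsGL a) (x : PFock l) :
    pDhatGL l a x = phi a ha x := by
  simp only [pDhatGL, pDhat_eq, phi_apply]

/-- `[Φ(a), χ_k] = -Σ_j a_{kj} χ_j` for a field `χ` of any species. -/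
theorem phi_mode {a : ℤ → ℤ → ℂ} (ha : IsGL a) (hd : IsDinf a) (t : Species l) (k : ℤ)
    (x : PFock l) {T : Finset ℤ} (hT : ∀ j, j ∉ T → a k j = 0) :
    phi a ha (mode t k x) = mode t k (phi a ha x) - ∑ j ∈ T, a k j • mode t j x := by
  have s1 : (Function.support fun p : ℤ × ℤ =>
      a p.1 p.2 • (if p.2 = 1 - k then mode t (1 - p.1) x else 0))
      ⊆ T.image fun j => (1 - j, 1 - k) := by
    rintro ⟨i, j⟩ hp
    by_contra h
    refine hp ?_
    by_cases hj : j = 1 - k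
    · have hi : 1 - i ∉ T := fun hi => h (by
        rw [Finset.mem_coe, Finset.mem_image]
        exact ⟨1 - i, hi, by rw [sub_sub_cancel, hj]⟩)
      have h0 : a i j = 0 := by rw [hd i j, hj, sub_sub_cancel, hT _ hi, neg_zero]
      simp [h0]
    · simp [hj]
  have s2 : (Function.support fun p : ℤ × ℤ => a p.1 p.2 • (if p.1 = k then mode t p.2 x else 0))
      ⊆ T.image fun j => (k, j) := by
    rintro ⟨i, j⟩ hp
    by_contra h
    refine hp ?_
    by_cases hi : i = k
    · have hj : j ∉ T := fun hj => h (by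
        rw [Finset.mem_coe, Finset.mem_image]
        exact ⟨j, hj, by rw [hi]⟩)
      simp [hi, hT _ hj]
    · simp [hi]
  have h1 : ∑ᶠ p : ℤ × ℤ, a p.1 p.2 • (if p.2 = 1 - k then mode t (1 - p.1) x else 0)
      = -∑ j ∈ T, a k j • mode t j x := by
    rw [finsum_eq_sum_of_support_subset _ s1, Finset.sum_image fun u _ v _ h => by simpa using h,
      ← Finset.sum_neg_distrib]
    exact Finset.sum_congr rfl fun j _ => by simp [hd k j]
  have h2 : ∑ᶠ p : ℤ × ℤ, a p.1 p.2 • (if p.1 = k then mode t p.2 x else 0)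
      = ∑ j ∈ T, a k j • mode t j x := by
    rw [finsum_eq_sum_of_support_subset _ s2, Finset.sum_image fun u _ v _ h => by simpa using h]
    exact Finset.sum_congr rfl fun j _ => by simp
  have f0 := finite_smul_dhat ha x
  have f0' : (Function.support fun p : ℤ × ℤ => mode t k (a p.1 p.2 • dhat p.1 p.2 x)).Finite :=
    f0.subset (Function.support_comp_subset (map_zero (mode t k)) _)
  have f1 := (Finset.finite_toSet _).subset s1
  have f2 := (Finset.finite_toSet _).subset s2
  have hterm : ∀ p : ℤ × ℤ, a p.1 p.2 • dhat p.1 p.2 (mode t k x)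
      = mode t k (a p.1 p.2 • dhat p.1 p.2 x)
        + (a p.1 p.2 • (if p.2 = 1 - k then mode t (1 - p.1) x else 0)
        - a p.1 p.2 • (if p.1 = k then mode t p.2 x else 0)) := fun p => by
    rw [dhat_mode, smul_add, smul_sub, map_smul]
  rw [phi_apply, phi_apply, finsum_congr hterm,
    finsum_add_distrib f0' ((f1.union f2).subset (Function.support_sub _ _)),
    finsum_sub_distrib f1 f2, h1, h2, ← map_finsum _ f0, smul_add, ← map_smul, ← neg_add',
    ← two_smul ℂ, smul_neg, smul_smul, sub_eq_add_neg]
  norm_num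

theorem exists_finset_forall_eq_zero {a : ℤ → ℤ → ℂ} (ha : IsGL a) (k : ℤ) :
    ∃ T : Finset ℤ, ∀ j, j ∉ T → a k j = 0 := by
  obtain ⟨N, hN⟩ := ha
  refine ⟨Finset.Icc (k - N) (k + N), fun j hj => hN k j ?_⟩
  by_contra h
  rw [not_lt, abs_le] at h
  exact hj (Finset.mem_Icc.2 (by omega))

theorem glMul_eq_sum {a b : ℤ → ℤ → ℂ} {k : ℤ} {T : Finset ℤ} (hT : ∀ j, j ∉ T → a k j = 0)
    (m : ℤ) : glMul a b k m = ∑ j ∈ T, a k j * b j m := by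
  refine finsum_eq_sum_of_support_subset _ fun j hj => ?_
  by_contra h
  exact hj (by simp [hT j h])

theorem isGL_glMul {a b : ℤ → ℤ → ℂ} (ha : IsGL a) (hb : IsGL b) : IsGL (glMul a b) := by
  obtain ⟨N, hN⟩ := ha
  obtain ⟨M, hM⟩ := hb
  refine ⟨N + M, fun i j hij => ?_⟩
  rw [glMul, finsum_eq_zero_of_forall_eq_zero]
  intro k
  rcases lt_or_ge (N : ℤ) |i - k| with h | h
  · rw [hN i k h, zero_mul]
  · rw [hM k j, mul_zero]
    have := abs_sub_le i k j
    push_cast at hij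
    linarith

theorem isGL_glBracket {a b : ℤ → ℤ → ℂ} (ha : IsGL a) (hb : IsGL b) : IsGL (glBracket a b) := by
  obtain ⟨N, hN⟩ := isGL_glMul ha hb
  obtain ⟨M, hM⟩ := isGL_glMul hb ha
  refine ⟨N + M, fun i j hij => ?_⟩
  push_cast at hij
  rw [glBracket, hN i j (by omega), hM i j (by omega), sub_zero]

theorem glMul_reflect {a b : ℤ → ℤ → ℂ} (ha : IsDinf a) (hb : IsDinf b) (i j : ℤ) :
    glMul a b (1 - j) (1 - i) = glMul b a i j := by
  rw [glMul, glMul, ← finsum_comp_equiv (Equiv.subLeft (1 : ℤ))]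
  refine finsum_congr fun k => ?_
  rw [Equiv.subLeft_apply, hb i k, ha k j]
  ring

theorem isDinf_glBracket {a b : ℤ → ℤ → ℂ} (ha : IsDinf a) (hb : IsDinf b) :
    IsDinf (glBracket a b) := fun i j => by
  rw [glBracket, glBracket, glMul_reflect ha hb, glMul_reflect hb ha, neg_sub]

/-- The operator `[Φ(a), Φ(b)] - Φ([a,b])`. -/
def commDefect {a b : ℤ → ℤ → ℂ} (ha : IsGL a) (hb : IsGL b) : Module.End ℂ (PFock l) :=
  phi a ha * phi b hb - phi b hb * phi a ha - phi (glBracket a b) (isGL_glBracket ha hb)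

theorem commDefect_apply {a b : ℤ → ℤ → ℂ} (ha : IsGL a) (hb : IsGL b) (x : PFock l) :
    commDefect ha hb x = phi a ha (phi b hb x) - phi b hb (phi a ha x)
      - phi (glBracket a b) (isGL_glBracket ha hb) x := rfl

theorem commDefect_mode {a b : ℤ → ℤ → ℂ} (ha : IsGL a) (hb : IsGL b) (hda : IsDinf a)
    (hdb : IsDinf b) (t : Species l) (k : ℤ) (x : PFock l) :
    commDefect ha hb (mode t k x) = mode t k (commDefect ha hb x) := by
  obtain ⟨Ta, hTa⟩ := exists_finset_forall_eq_zero ha k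
  obtain ⟨Tb, hTb⟩ := exists_finset_forall_eq_zero hb k
  obtain ⟨T, hT, hT'⟩ : ∃ T : Finset ℤ, (∀ j, j ∉ T → a k j = 0) ∧ ∀ j, j ∉ T → b k j = 0 :=
    ⟨Ta ∪ Tb, fun j hj => hTa j fun h => hj (Finset.mem_union_left _ h),
      fun j hj => hTb j fun h => hj (Finset.mem_union_right _ h)⟩
  choose Ua hUa using fun j => exists_finset_forall_eq_zero ha j
  choose Ub hUb using fun j => exists_finset_forall_eq_zero hb j
  obtain ⟨U, hU, hU'⟩ : ∃ U : Finset ℤ, (∀ j ∈ T, ∀ m, m ∉ U → a j m = 0) ∧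
      ∀ j ∈ T, ∀ m, m ∉ U → b j m = 0 :=
    ⟨T.biUnion fun j => Ua j ∪ Ub j,
      fun j hj m hm => hUa j m fun h => hm (Finset.mem_biUnion.2 ⟨j, hj, Finset.mem_union_left _ h⟩),
      fun j hj m hm => hUb j m fun h => hm (Finset.mem_biUnion.2 ⟨j, hj, Finset.mem_union_right _ h⟩)⟩
  have hbr : ∀ m, glBracket a b k m = ∑ j ∈ T, (a k j * b j m - b k j * a j m) := fun m => by
    rw [glBracket, glMul_eq_sum hT, glMul_eq_sum hT', Finset.sum_sub_distrib]
  have hbU : ∀ m, m ∉ U → glBracket a b k m = 0 := fun m hm => by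
    rw [hbr, Finset.sum_eq_zero]
    intro j hj
    rw [hU j hj m hm, hU' j hj m hm, mul_zero, mul_zero, sub_zero]
  have e1 : phi a ha (∑ j ∈ T, b k j • mode t j x)
      = ∑ j ∈ T, b k j • mode t j (phi a ha x) - ∑ m ∈ U, (∑ j ∈ T, b k j * a j m) • mode t m x := by
    simp only [map_sum, map_smul, Finset.sum_smul]
    rw [Finset.sum_comm, ← Finset.sum_sub_distrib]
    refine Finset.sum_congr rfl fun j hj => ?_
    rw [phi_mode ha hda t j x (hU j hj), smul_sub, Finset.smul_sum]
    simp only [smul_smul]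
  have e2 : phi b hb (∑ j ∈ T, a k j • mode t j x)
      = ∑ j ∈ T, a k j • mode t j (phi b hb x) - ∑ m ∈ U, (∑ j ∈ T, a k j * b j m) • mode t m x := by
    simp only [map_sum, map_smul, Finset.sum_smul]
    rw [Finset.sum_comm, ← Finset.sum_sub_distrib]
    refine Finset.sum_congr rfl fun j hj => ?_
    rw [phi_mode hb hdb t j x (hU' j hj), smul_sub, Finset.smul_sum]
    simp only [smul_smul]
  simp only [commDefect_apply, map_sub]
  rw [phi_mode hb hdb t k x hT', phi_mode ha hda t k x hT,
    phi_mode (isGL_glBracket ha hb) (isDinf_glBracket hda hdb) t k x hbU, map_sub, map_sub,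
    phi_mode ha hda t k _ hT, phi_mode hb hdb t k _ hT', e1, e2]
  simp only [hbr, Finset.sum_sub_distrib, sub_smul]
  abel

theorem vev_dhat_vacuum (i j : ℤ) : vev (dhat i j (1 : PFock l)) = 0 := by
  rw [dhat_apply, map_sum]
  refine Finset.sum_eq_zero fun s _ => ?_
  rw [map_sub, vev_mode_mode]
  by_cases h : i = j ∧ j ≤ 0
  · rw [if_pos h, if_pos (by omega), vev_one, sub_self]
  · rw [if_neg h, if_neg (by omega), map_zero, sub_self]

theorem vev_phi_vacuum (a : ℤ → ℤ → ℂ) (ha : IsGL a) : vev (phi a ha (1 : PFock l)) = 0 := by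
  rw [phi_apply, map_smul, map_finsum _ (finite_smul_dhat ha _), finsum_eq_zero_of_forall_eq_zero,
    smul_zero]
  intro p
  rw [map_smul, vev_dhat_vacuum, smul_zero]

theorem vev_phi_dhat_vacuum {a : ℤ → ℤ → ℂ} (ha : IsGL a) (hd : IsDinf a) (m n : ℤ) :
    vev (phi a ha (dhat m n (1 : PFock l)))
      = if n ≤ 0 ∧ 0 < m then (2 * l + 1 : ℂ) * a n m else 0 := by
  have hterm : ∀ s : Species l, vev (phi a ha (mode s (1 - m) (mode (conj s) n (1 : PFock l))
      - if m = n ∧ n ≤ 0 then 1 else 0)) = if n ≤ 0 ∧ 0 < m then a n m else 0 := by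
    intro s
    by_cases hn : n ≤ 0
    · by_cases hm : 0 < m
      · obtain ⟨T, hT⟩ := exists_finset_forall_eq_zero ha (1 - m)
        rw [if_neg (by omega), sub_zero, phi_mode ha hd s _ _ hT, map_sub,
          vev_mode s (by omega), if_pos ⟨hn, hm⟩, zero_sub, map_sum, hd n m,
          Finset.sum_eq_single (1 - n)]
        · rw [map_smul, vev_mode_mode, if_pos (by omega), smul_eq_mul, mul_one]
        · intro j _ hj
          rw [map_smul, vev_mode_mode, if_neg (by omega), smul_zero]
        · intro h
          rw [hT _ h, zero_smul, map_zero]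
      · have h := mode_anticomm s (conj s) (1 - m) n 1
        rw [mode_vacuum s (by omega), map_zero, add_zero] at h
        rw [h, if_neg (by omega : ¬(n ≤ 0 ∧ 0 < m))]
        by_cases hmn : m = n
        · rw [if_pos (by simp [hmn]), if_pos (by omega), sub_self, map_zero, map_zero]
        · rw [if_neg (by omega), if_neg (by omega), sub_self, map_zero, map_zero]
    · rw [mode_vacuum _ (by omega), map_zero, if_neg (by omega), if_neg (by omega), sub_self,
        map_zero, map_zero]
  rw [dhat_apply, map_sum, map_sum]
  simp only [hterm, Finset.sum_const, Finset.card_univ, Fintype.card_option, Fintype.card_prod,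
    Fintype.card_bool, Fintype.card_fin, nsmul_eq_mul]
  push_cast
  rw [mul_ite, mul_zero]

theorem vev_phi_phi_vacuum {a b : ℤ → ℤ → ℂ} (ha : IsGL a) (hb : IsGL b) (hd : IsDinf a) :
    vev (phi a ha (phi b hb (1 : PFock l)))
      = (l + 1 / 2 : ℂ) * ∑ᶠ p : ℤ × ℤ, if p.2 ≤ 0 ∧ 0 < p.1 then a p.2 p.1 * b p.1 p.2 else 0 := by
  have h := map_finsum (vev ∘ₗ phi a ha) (finite_smul_dhat hb (1 : PFock l))
  rw [phi_apply b, map_smul, map_smul]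
  rw [LinearMap.comp_apply] at h
  rw [h, ← smul_eq_mul, smul_finsum, smul_finsum]
  refine finsum_congr fun p => ?_
  rw [LinearMap.comp_apply, map_smul, map_smul, vev_phi_dhat_vacuum ha hd]
  split_ifs
  · simp only [smul_eq_mul]; ring
  · simp only [smul_zero]

/-- The commutator formula in terms of the linear maps `phi`. -/
theorem phi_commutator {a b : ℤ → ℤ → ℂ} (ha : IsGL a) (hb : IsGL b) (hda : IsDinf a)
    (hdb : IsDinf b) (x : PFock l) :
    phi a ha (phi b hb x) - phi b hb (phi a ha x)
      = phi (glBracket a b) (isGL_glBracket ha hb) x + ((l + 1 / 2 : ℂ) * glCocycle a b) • x := by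
  have h := eq_zero_of_commute_mode (commDefect ha hb - ((l + 1 / 2 : ℂ) * glCocycle a b) • 1)
    (fun s k y => by
      simp only [LinearMap.sub_apply, LinearMap.smul_apply, Module.End.one_apply, map_sub, map_smul,
        commDefect_mode ha hb hda hdb]) (by
      have hswap : (∑ᶠ p : ℤ × ℤ, if p.2 ≤ 0 ∧ 0 < p.1 then a p.2 p.1 * b p.1 p.2 else 0)
          = ∑ᶠ p : ℤ × ℤ, if p.1 ≤ 0 ∧ 0 < p.2 then a p.1 p.2 * b p.2 p.1 else 0 :=
        finsum_comp_equiv (Equiv.prodComm ℤ ℤ)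
          (f := fun p : ℤ × ℤ => if p.1 ≤ 0 ∧ 0 < p.2 then a p.1 p.2 * b p.2 p.1 else 0)
      simp only [LinearMap.sub_apply, commDefect_apply, LinearMap.smul_apply,
        Module.End.one_apply, map_sub, map_smul, vev_phi_phi_vacuum ha hb hda,
        vev_phi_phi_vacuum hb ha hdb, vev_phi_vacuum, vev_one, hswap, glCocycle,
        mul_comm (b _ _) (a _ _), smul_eq_mul]
      ring) x
  simp only [LinearMap.sub_apply, commDefect_apply, LinearMap.smul_apply,
    Module.End.one_apply] at h
  rw [sub_sub, sub_eq_zero] at h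
  exact h

theorem finsum_Emat_smul {M : Type*} [AddCommGroup M] [Module ℂ M] (i j : ℤ) (f : ℤ → ℤ → M) :
    ∑ᶠ p : ℤ × ℤ, Emat i j p.1 p.2 • f p.1 p.2 = f i j := by
  rw [finsum_eq_single _ (i, j)]
  · simp [Emat]
  · rintro ⟨m, n⟩ h
    rw [ne_eq, Prod.mk.injEq] at h
    simp [Emat, h]

theorem finite_Emat_smul {M : Type*} [AddCommGroup M] [Module ℂ M] (i j : ℤ) (f : ℤ → ℤ → M) :
    (Function.support fun p : ℤ × ℤ => Emat i j p.1 p.2 • f p.1 p.2).Finite := by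
  refine (Set.finite_singleton (i, j)).subset ?_
  rintro ⟨m, n⟩ h
  by_contra h'
  rw [Set.mem_singleton_iff, Prod.mk.injEq] at h'
  exact h (by simp [Emat, h'])

end PFock

/-- (1) `D̂'_{1-j,1-i} = -D̂'_{ij}`; (2) for `a ∈ d̄∞` the sum defining
`Φ(a) x = ½ Σ_{ij} a_{ij} D̂'_{ij} x` has finitely many nonzero terms, and
`Φ(E_{ij} - E_{1-j,1-i}) = D̂'_{ij}`; (3) `[Φ(a), Φ(b)] = Φ([a,b]) + (l+½)·C(a,b)·id`,
i.e. `a + λC ↦ Φ(a) + λ(l+½)·id` is a representation of the central extension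
`d∞ = d̄∞ ⊕ ℂC` on `F'` of central charge `l + ½`. -/
theorem pDhat_representation (l : ℕ) (hl : 1 ≤ l) :
    (∀ (i j : ℤ) (x : PFock l), pDhat l (1 - j) (1 - i) x = -(pDhat l i j x)) ∧
    (∀ (a : ℤ → ℤ → ℂ), IsGL a → IsDinf a → ∀ x : PFock l,
      {p : ℤ × ℤ | a p.1 p.2 • pDhat l p.1 p.2 x ≠ 0}.Finite) ∧
    (∀ (i j : ℤ) (x : PFock l),
      pDhatGL l (fun s t => Emat i j s t - Emat (1 - j) (1 - i) s t) x = pDhat l i j x) ∧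
    (∀ (a b : ℤ → ℤ → ℂ), IsGL a → IsGL b → IsDinf a → IsDinf b → ∀ x : PFock l,
      pDhatGL l a (pDhatGL l b x) - pDhatGL l b (pDhatGL l a x)
        = pDhatGL l (glBracket a b) x + ((((l : ℂ) + 1 / 2)) * glCocycle a b) • x) := by
  refine ⟨fun i j x => ?_, fun a ha _ x => ?_, fun i j x => ?_, fun a b ha hb hda hdb x => ?_⟩
  · rw [PFock.pDhat_eq, PFock.pDhat_eq, PFock.dhat_symm]
  · simp only [PFock.pDhat_eq]
    exact PFock.finite_smul_dhat ha x
  · simp only [pDhatGL, PFock.pDhat_eq, sub_smul]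
    rw [finsum_sub_distrib (PFock.finite_Emat_smul i j fun s t => PFock.dhat s t x)
        (PFock.finite_Emat_smul (1 - j) (1 - i) fun s t => PFock.dhat s t x),
      PFock.finsum_Emat_smul i j fun s t => PFock.dhat s t x,
      PFock.finsum_Emat_smul (1 - j) (1 - i) fun s t => PFock.dhat s t x, PFock.dhat_symm,
      sub_neg_eq_add, ← two_smul ℂ, smul_smul]
    norm_num
  · simp only [PFock.pDhatGL_eq a ha, PFock.pDhatGL_eq b hb,
      PFock.pDhatGL_eq _ (PFock.isGL_glBracket ha hb)]
    exact PFock.phi_commutator ha hb hda hdb x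

end
end
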